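/- arXiv:2509.01572 — 3 statements merged into one kernel-verified Lean document; each statement's English description precedes it below -/
import Mathlib

section
/- Let A be a real m×n matrix with AAᵀ = diag(a₁, …, aₘ), let γ > 0 with 1 + γaᵢ ≠ 0 for every i, and let v ∈ ℝⁿ, y ∈ ℝᵐ. Then (I + γAᵀA)⁻¹(v + γAᵀy) = v + γ·Aᵀw, where w ∈ ℝᵐ is the vector with components wᵢ = (yᵢ − (Av)ᵢ)/(1 + γaᵢ). This is the simplified closed-form ADMM x-update x = (z − s) + γAᵀ((y − A(z − s)) ⊘ (γ·Diag(AAᵀ) + 1)) used in snapshot compressive imaging. -/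
open Matrix

/-- The simplified closed-form ADMM x-update for snapshot compressive imaging:
if `AAᵀ = diag(a₁, …, aₘ)` then
`(I + γAᵀA)⁻¹(v + γAᵀy) = v + γAᵀw` where `wᵢ = (yᵢ − (Av)ᵢ)/(1 + γaᵢ)`. -/
theorem stmt_10 {m n : ℕ} (A : Matrix (Fin m) (Fin n) ℝ) (γ : ℝ) (hγ : 0 < γ)
    (a : Fin m → ℝ) (hdiag : A * Aᵀ = Matrix.diagonal a) (ha : ∀ i, 1 + γ * a i ≠ 0)
    (v : Fin n → ℝ) (y : Fin m → ℝ) :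
    ((1 : Matrix (Fin n) (Fin n) ℝ) + γ • (Aᵀ * A))⁻¹ *ᵥ (v + γ • (Aᵀ *ᵥ y)) =
      v + γ • (Aᵀ *ᵥ fun i => (y i - (A *ᵥ v) i) / (1 + γ * a i)) := by
  have hpos : ((1 : Matrix (Fin n) (Fin n) ℝ) + γ • (Aᵀ * A)).PosDef := by
    have h := (Matrix.posSemidef_conjTranspose_mul_self A).smul hγ.le
    rw [Matrix.conjTranspose_eq_transpose_of_trivial] at h
    exact Matrix.PosDef.one.add_posSemidef h
  have hunit := (Matrix.isUnit_iff_isUnit_det _).mp hpos.isUnit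
  set w : Fin m → ℝ := fun i => (y i - (A *ᵥ v) i) / (1 + γ * a i) with hw
  have hy : y = w + A *ᵥ v + γ • (A *ᵥ (Aᵀ *ᵥ w)) := by
    ext i
    have hi := ha i
    rw [Matrix.mulVec_mulVec, hdiag]
    simp only [Pi.add_apply, Pi.smul_apply, smul_eq_mul, Matrix.mulVec_diagonal, hw]
    field_simp
    ring
  have key : ((1 : Matrix (Fin n) (Fin n) ℝ) + γ • (Aᵀ * A)) *ᵥ (v + γ • (Aᵀ *ᵥ w)) =
      v + γ • (Aᵀ *ᵥ y) := by
    conv_rhs => rw [hy]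
    simp only [Matrix.add_mulVec, Matrix.one_mulVec, Matrix.smul_mulVec, Matrix.mulVec_add,
      Matrix.mulVec_smul, ← Matrix.mulVec_mulVec, smul_add]
    abel
  rw [← key, Matrix.mulVec_mulVec, Matrix.nonsing_inv_mul _ hunit, Matrix.one_mulVec]
end

section
/- Let E be a finite-dimensional real inner product space, f : E → E a differentiable map, and λ ∈ ℝ. Assume that for every x ∈ E the Jacobian (Fréchet derivative) J_f(x) is self-adjoint, and that f satisfies J_f(x)·x = f(x) for all x (the consequence of local homogeneity). Then the RED regularizer r(x) = (λ/2)·⟪x, x − f(x)⟫ is differentiable with gradient ∇r(x) = λ·(x − f(x)) for every x ∈ E. -/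
open RealInnerProductSpace

/-- The RED gradient rule: if the denoiser `f` has a self-adjoint Jacobian
satisfying `J_f(x)·x = f(x)`, then the RED regularizer
`r(x) = (λ/2)⟪x, x − f(x)⟫` has gradient `∇r(x) = λ(x − f(x))`. -/
theorem stmt_13 {E : Type*} [NormedAddCommGroup E] [InnerProductSpace ℝ E]
    [FiniteDimensional ℝ E]
    (f : E → E) (f' : E → E →L[ℝ] E) (lam : ℝ)
    (hdiff : ∀ x, HasFDerivAt f (f' x) x)
    (hsa : ∀ x u v, ⟪f' x u, v⟫ = ⟪u, f' x v⟫)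
    (hhom : ∀ x, f' x x = f x) :
    ∀ x : E, HasGradientAt (fun x => (lam / 2) * ⟪x, x - f x⟫) (lam • (x - f x)) x := by
  intro x
  rw [hasGradientAt_iff_hasFDerivAt]
  have h := ((hasFDerivAt_id x).inner ℝ ((hasFDerivAt_id x).sub (hdiff x))).const_mul (lam / 2)
  refine h.congr_fderiv ?_
  ext v
  have hv : ⟪x, f' x v⟫ = ⟪f x, v⟫ := by rw [← hsa, hhom]
  simp [inner_sub_right, hv, real_inner_comm v]
  ring
end

section
/- Let A be a real m×n matrix, y ∈ ℝᵐ, λ ∈ ℝ, and let f : ℝⁿ → ℝⁿ be a differentiable map such that for every x the Jacobian J_f(x) is self-adjoint and J_f(x)·x = f(x). Then the RED objective E(x) = (1/2)·‖Ax − y‖² + (λ/2)·⟪x, x − f(x)⟫ is differentiable with gradient ∇E(x) = Aᵀ(Ax − y) + λ·(x − f(x)) for every x ∈ ℝⁿ; consequently any minimizer x of E satisfies Aᵀ(Ax − y) + λ(x − f(x)) = 0. -/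
open Matrix

open RealInnerProductSpace

section RED

variable {E F : Type*} [NormedAddCommGroup E] [InnerProductSpace ℝ E] [CompleteSpace E]
  [NormedAddCommGroup F] [InnerProductSpace ℝ F] [CompleteSpace F]

theorem hasGradientAt_half_norm_sub_sq (L : E →L[ℝ] F) (y : F) (x : E) :
    HasGradientAt (fun z => (1 / 2 : ℝ) * ‖L z - y‖ ^ 2)
      (ContinuousLinearMap.adjoint L (L x - y)) x := by
  rw [hasGradientAt_iff_hasFDerivAt]
  refine (((L.hasFDerivAt (x := x)).sub_const y).norm_sq.const_mul (1 / 2 : ℝ)).congr_fderiv ?_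
  ext v
  simp [ContinuousLinearMap.adjoint_inner_left]

/-- If the derivative of `f` at `x` is self-adjoint and maps `x` to `f x`, then the gradient of
`z ↦ ⟪z, z - f z⟫` at `x` is twice the residual. -/
theorem hasGradientAt_inner_sub_self {f : E → E} {f' : E →L[ℝ] E} {x : E}
    (hf : HasFDerivAt f f' x) (hsa : ∀ u v, ⟪f' u, v⟫ = ⟪u, f' v⟫) (hhom : f' x = f x) :
    HasGradientAt (fun z => ⟪z, z - f z⟫) ((2 : ℝ) • (x - f x)) x := by
  rw [hasGradientAt_iff_hasFDerivAt]
  refine ((hasFDerivAt_id x).inner ℝ ((hasFDerivAt_id x).sub hf)).congr_fderiv ?_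
  ext v
  have h : ⟪x, f' v⟫ = ⟪f x, v⟫ := by rw [← hsa, hhom]
  simp [inner_sub_right, h, real_inner_comm]
  ring

theorem hasGradientAt_red_objective (L : E →L[ℝ] F) (y : F) (c : ℝ) {f : E → E}
    {f' : E →L[ℝ] E} {x : E} (hf : HasFDerivAt f f' x)
    (hsa : ∀ u v, ⟪f' u, v⟫ = ⟪u, f' v⟫) (hhom : f' x = f x) :
    HasGradientAt (fun z => (1 / 2) * ‖L z - y‖ ^ 2 + (c / 2) * ⟪z, z - f z⟫)
      (ContinuousLinearMap.adjoint L (L x - y) + c • (x - f x)) x := by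
  rw [hasGradientAt_iff_hasFDerivAt]
  refine ((hasGradientAt_half_norm_sub_sq L y x).hasFDerivAt.add
    ((hasGradientAt_inner_sub_self hf hsa hhom).hasFDerivAt.const_mul (c / 2))).congr_fderiv ?_
  ext v
  simp
  ring

theorem IsLocalMin.hasGradientAt_eq_zero {g : E → ℝ} {g' x : E} (h : IsLocalMin g x)
    (hg : HasGradientAt g g' x) : g' = 0 :=
  (map_eq_zero_iff _ (InnerProductSpace.toDual ℝ E).injective).1
    (h.hasFDerivAt_eq_zero hg.hasFDerivAt)

end RED

theorem Matrix.toEuclideanLin_transpose_apply {m n : ℕ} (A : Matrix (Fin m) (Fin n) ℝ)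
    (v : EuclideanSpace ℝ (Fin m)) :
    Matrix.toEuclideanLin Aᵀ v =
      ContinuousLinearMap.adjoint (Matrix.toEuclideanLin A).toContinuousLinearMap v := by
  rw [← Matrix.conjTranspose_eq_transpose_of_trivial,
    Matrix.toEuclideanLin_conjTranspose_eq_adjoint]
  rfl

/-- The gradient of the RED objective
`E(x) = (1/2)‖Ax − y‖² + (λ/2)⟪x, x − f(x)⟫` is
`∇E(x) = Aᵀ(Ax − y) + λ(x − f(x))`; consequently any minimizer `x` of `E`
satisfies `Aᵀ(Ax − y) + λ(x − f(x)) = 0`. -/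
theorem stmt_15 {m n : ℕ} (A : Matrix (Fin m) (Fin n) ℝ) (y : EuclideanSpace ℝ (Fin m))
    (lam : ℝ) (f : EuclideanSpace ℝ (Fin n) → EuclideanSpace ℝ (Fin n))
    (f' : EuclideanSpace ℝ (Fin n) → EuclideanSpace ℝ (Fin n) →L[ℝ] EuclideanSpace ℝ (Fin n))
    (hdiff : ∀ x, HasFDerivAt f (f' x) x)
    (hsa : ∀ x u v, ⟪f' x u, v⟫ = ⟪u, f' x v⟫)
    (hhom : ∀ x, f' x x = f x) :
    (∀ x : EuclideanSpace ℝ (Fin n),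
      HasGradientAt (fun x : EuclideanSpace ℝ (Fin n) =>
          (1 / 2) * ‖Matrix.toEuclideanLin A x - y‖ ^ 2 + (lam / 2) * ⟪x, x - f x⟫)
        (Matrix.toEuclideanLin Aᵀ (Matrix.toEuclideanLin A x - y) + lam • (x - f x)) x) ∧
    ∀ x : EuclideanSpace ℝ (Fin n),
      (∀ x' : EuclideanSpace ℝ (Fin n),
        (1 / 2) * ‖Matrix.toEuclideanLin A x - y‖ ^ 2 + (lam / 2) * ⟪x, x - f x⟫ ≤
          (1 / 2) * ‖Matrix.toEuclideanLin A x' - y‖ ^ 2 + (lam / 2) * ⟪x', x' - f x'⟫) →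
      Matrix.toEuclideanLin Aᵀ (Matrix.toEuclideanLin A x - y) + lam • (x - f x) = 0 := by
  have hgrad := fun x => hasGradientAt_red_objective
    (Matrix.toEuclideanLin A).toContinuousLinearMap y lam (hdiff x) (hsa x) (hhom x)
  simp only [← Matrix.toEuclideanLin_transpose_apply,
    LinearMap.coe_toContinuousLinearMap'] at hgrad
  exact ⟨hgrad, fun x hx => IsLocalMin.hasGradientAt_eq_zero (.of_forall hx) (hgrad x)⟩
end
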